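/- For any finite game with uncertainty (N players, finite nonempty action sets 𝒜_i, finite nonempty parameter set Θ, utility functions U_i : (∏_j 𝒜_j) × Θ → ℝ), there exists a complete strategy profile (σ*; π*), with σ*_i a probability distribution on 𝒜_i and π*_i a probability distribution on Θ for each i, which is an extended equilibrium: for every player i and every action a_i ∈ 𝒜_i, EU_i(σ*;π*) ≥ EU_i(a_i | σ*;π*), and for every player i and every parameter value θ ∈ Θ, ER_i(σ*;π*) ≥ ER_i(θ | σ*;π*). -/

import Mathlib

open Finset

noncomputable section

/-- A probability distribution on a finite type. -/
def IsDist {α : Type*} [Fintype α] (p : α → ℝ) : Prop :=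
  (∀ x, 0 ≤ p x) ∧ ∑ x, p x = 1

variable {N : ℕ} {A : Fin N → Type*} [∀ j, Fintype (A j)] [∀ j, Nonempty (A j)]
  {Θ : Type*} [Fintype Θ] [Nonempty Θ]

/-- `Π(a|σ) = ∏ⱼ σⱼ(aⱼ)`. -/
def piProb (σ : ∀ j : Fin N, A j → ℝ) (a : ∀ j : Fin N, A j) : ℝ := ∏ j, σ j (a j)

/-- Effective utility matrix `EUᵢ(aᵢ;θ|σ)`. -/
def EUmat (U : ∀ i : Fin N, (∀ j : Fin N, A j) → Θ → ℝ) (σ : ∀ j : Fin N, A j → ℝ)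
    (i : Fin N) (ai : A i) (θ : Θ) : ℝ :=
  ∑ b : ∀ j : Fin N, A j, U i (Function.update b i ai) θ * piProb σ b

/-- Effective regret matrix `ERᵢ(aᵢ;θ|σ)`. -/
def ERmat (U : ∀ i : Fin N, (∀ j : Fin N, A j) → Θ → ℝ) (σ : ∀ j : Fin N, A j → ℝ)
    (i : Fin N) (ai : A i) (θ : Θ) : ℝ :=
  (Finset.univ.sup' Finset.univ_nonempty fun ci : A i => EUmat U σ i ci θ) - EUmat U σ i ai θ

/-- Expected utility of action `aᵢ`: `EUᵢ(aᵢ|σ;π)`. -/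
def EUact (U : ∀ i : Fin N, (∀ j : Fin N, A j) → Θ → ℝ) (σ : ∀ j : Fin N, A j → ℝ) (π : Fin N → Θ → ℝ)
    (i : Fin N) (ai : A i) : ℝ :=
  ∑ θ, EUmat U σ i ai θ * π i θ

/-- Expected utility `EUᵢ(σ;π)`. -/
def EUtot (U : ∀ i : Fin N, (∀ j : Fin N, A j) → Θ → ℝ) (σ : ∀ j : Fin N, A j → ℝ) (π : Fin N → Θ → ℝ)
    (i : Fin N) : ℝ :=
  ∑ ai, EUact U σ π i ai * σ i ai

/-- Expected regret at parameter `θ`: `ERᵢ(θ|σ;π)`. -/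
def ERparam (U : ∀ i : Fin N, (∀ j : Fin N, A j) → Θ → ℝ) (σ : ∀ j : Fin N, A j → ℝ)
    (i : Fin N) (θ : Θ) : ℝ :=
  ∑ ai, ERmat U σ i ai θ * σ i ai

/-- Expected regret `ERᵢ(σ;π)`. -/
def ERtot (U : ∀ i : Fin N, (∀ j : Fin N, A j) → Θ → ℝ) (σ : ∀ j : Fin N, A j → ℝ) (π : Fin N → Θ → ℝ)
    (i : Fin N) : ℝ :=
  ∑ θ, ERparam U σ i θ * π i θ

/-- Extended equilibrium conditions. -/
def ExtendedEquilibrium (U : ∀ i : Fin N, (∀ j : Fin N, A j) → Θ → ℝ)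
    (σ : ∀ j : Fin N, A j → ℝ) (π : Fin N → Θ → ℝ) : Prop :=
  (∀ i, ∀ ai : A i, EUtot U σ π i ≥ EUact U σ π i ai) ∧
  (∀ i, ∀ θ : Θ, ERtot U σ π i ≥ ERparam U σ i θ)

/-- φ_{i,aᵢ}(σ;π). -/
def phi (U : ∀ i : Fin N, (∀ j : Fin N, A j) → Θ → ℝ) (σ : ∀ j : Fin N, A j → ℝ) (π : Fin N → Θ → ℝ)
    (i : Fin N) (ai : A i) : ℝ :=
  max 0 (EUact U σ π i ai - EUtot U σ π i)

/-- ψ_{i,θ}(σ;π). -/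
def psi (U : ∀ i : Fin N, (∀ j : Fin N, A j) → Θ → ℝ) (σ : ∀ j : Fin N, A j → ℝ) (π : Fin N → Θ → ℝ)
    (i : Fin N) (θ : Θ) : ℝ :=
  max 0 (ERparam U σ i θ - ERtot U σ π i)

/-- Real-strategy part of the auxiliary map `Υ`. -/
def nextStrat (U : ∀ i : Fin N, (∀ j : Fin N, A j) → Θ → ℝ) (σ : ∀ j : Fin N, A j → ℝ) (π : Fin N → Θ → ℝ)
    (i : Fin N) (ai : A i) : ℝ :=
  (σ i ai + phi U σ π i ai) / (1 + ∑ bi, phi U σ π i bi)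

/-- Prior part of the auxiliary map `Υ`. -/
def nextPrior (U : ∀ i : Fin N, (∀ j : Fin N, A j) → Θ → ℝ) (σ : ∀ j : Fin N, A j → ℝ) (π : Fin N → Θ → ℝ)
    (i : Fin N) (θ : Θ) : ℝ :=
  (π i θ + psi U σ π i θ) / (1 + ∑ χ, psi U σ π i χ)

/-- The auxiliary map `Υ`. -/
def Upsilon (U : ∀ i : Fin N, (∀ j : Fin N, A j) → Θ → ℝ)
    (ρ : (∀ i, A i → ℝ) × (Fin N → Θ → ℝ)) : (∀ i, A i → ℝ) × (Fin N → Θ → ℝ) :=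
  (fun i => nextStrat U ρ.1 ρ.2 i, fun i => nextPrior U ρ.1 ρ.2 i)

section Brouwer

open Metric MeasureTheory Polynomial

/-- `det (1 + t • L)` is a polynomial of degree at most the dimension in `t`. -/
lemma exists_polynomial_eval_eq_det_one_add_smul {E : Type*} [NormedAddCommGroup E]
    [NormedSpace ℝ E] [FiniteDimensional ℝ E] (L : E →L[ℝ] E) :
    ∃ p : ℝ[X], p.natDegree ≤ Module.finrank ℝ E ∧ ∀ t : ℝ, p.eval t = (1 + t • L).det := by
  let b := Module.finBasis ℝ E
  let M := LinearMap.toMatrix b b (L : E →ₗ[ℝ] E)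
  refine ⟨((X : ℝ[X]) • M.map C + (1 : Matrix _ _ ℝ).map C).det, ?_, fun t => ?_⟩
  · simpa using natDegree_det_X_add_C_le M 1
  · rw [ContinuousLinearMap.det, ← LinearMap.det_toMatrix b, ← coe_evalRingHom, RingHom.map_det]
    congr 1
    ext i j
    by_cases h : i = j <;>
      simp [M, LinearMap.toMatrix_apply, h, add_comm, mul_comm t]

/-- Evaluation at `1` of a polynomial of degree at most `d` is a fixed affine combination of its
values at any `d + 1` distinct nodes. -/
lemma exists_weights_eval_one_eq_sum (d : ℕ) (v : ℕ → ℝ) (hv : Function.Injective v) :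
    ∃ w : ℕ → ℝ, ∑ k ∈ range (d + 1), w k = 1 ∧
      ∀ p : ℝ[X], p.natDegree ≤ d → p.eval 1 = ∑ k ∈ range (d + 1), w k * p.eval (v k) := by
  have key : ∀ p : ℝ[X], p.natDegree ≤ d → p.eval 1 =
      ∑ k ∈ range (d + 1), (Lagrange.basis (range (d + 1)) v k).eval 1 * p.eval (v k) := by
    intro p hp
    have h := Lagrange.eq_interpolate_of_eval_eq (s := range (d + 1)) (v := v)
      (r := fun k => p.eval (v k)) (f := p) hv.injOn
      (by
        rw [card_range]
        exact lt_of_le_of_lt degree_le_natDegree (by exact_mod_cast Nat.lt_succ_of_le hp))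
      (fun _ _ => rfl)
    conv_lhs => rw [h, Lagrange.interpolate_apply, eval_finsetSum]
    simp [mul_comm]
  refine ⟨_, ?_, key⟩
  simpa using (key 1 (by simp)).symm

lemma det_one_add_pos {E : Type*} [NormedAddCommGroup E] [NormedSpace ℝ E]
    [FiniteDimensional ℝ E] {L : E →L[ℝ] E} (hL : ‖L‖ < 1) : 0 < (1 + L).det := by
  have hne : ∀ s ∈ Set.Icc (0 : ℝ) 1, (1 + s • L).det ≠ 0 := by
    intro s hs h0
    obtain ⟨v, hv, hv0⟩ := (Submodule.ne_bot_iff _).1 (LinearMap.bot_lt_ker_of_det_eq_zero h0).ne'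
    have hv' : v = -(s • L v) := by
      have : v + s • L v = 0 := by simpa using hv
      exact eq_neg_of_add_eq_zero_left this
    have h1 : ‖v‖ ≤ ‖L‖ * ‖v‖ := by
      calc ‖v‖ = |s| * ‖L v‖ := by conv_lhs => rw [hv', norm_neg, norm_smul, Real.norm_eq_abs]
        _ ≤ 1 * (‖L‖ * ‖v‖) := by
          gcongr
          · rw [abs_of_nonneg hs.1]; exact hs.2
          · exact L.le_opNorm v
        _ = _ := one_mul _
    have := norm_pos_iff.2 hv0
    nlinarith
  by_contra! hle
  have hc : Continuous fun s : ℝ => (1 + s • L).det :=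
    ContinuousLinearMap.continuous_det.comp (by fun_prop)
  obtain ⟨s, hs, h0⟩ := intermediate_value_Icc' (zero_le_one' ℝ) hc.continuousOn
    (show (0 : ℝ) ∈ Set.Icc _ _ by
      refine ⟨by simpa using hle, ?_⟩
      simp [ContinuousLinearMap.det])
  exact hne s hs h0

/-- A Lipschitz function on the closed unit ball that vanishes on the sphere stays Lipschitz when
extended by zero. -/
lemma LipschitzOnWith.extend_zero_closedBall {E F : Type*} [NormedAddCommGroup E]
    [NormedSpace ℝ E] [NormedAddCommGroup F] {K : NNReal} {h : E → F}
    (hh : LipschitzOnWith K h (closedBall 0 1)) (h0 : ∀ x, ‖x‖ = 1 → h x = 0) :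
    LipschitzWith K ((closedBall (0 : E) 1).indicator h) := by
  classical
  have mixed : ∀ x y : E, ‖x‖ ≤ 1 → 1 < ‖y‖ → dist (h x) 0 ≤ K * dist x y := by
    intro x y hx hy
    have hc : Continuous fun s : ℝ => ‖AffineMap.lineMap x y s‖ := by
      have : Continuous fun s : ℝ => AffineMap.lineMap x y s := AffineMap.lineMap_continuous
      fun_prop
    obtain ⟨s, hs, h1⟩ := intermediate_value_Icc (zero_le_one' ℝ) hc.continuousOn
      (show (1 : ℝ) ∈ Set.Icc _ _ by simpa using ⟨hx, hy.le⟩)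
    have h1' : ‖AffineMap.lineMap x y s‖ = 1 := h1
    rw [← h0 _ h1']
    refine (hh.dist_le_mul x (by simpa using hx) _ (by simp [h1'])).trans ?_
    gcongr
    rw [dist_left_lineMap, Real.norm_of_nonneg hs.1]
    exact mul_le_of_le_one_left dist_nonneg hs.2
  refine LipschitzWith.of_dist_le_mul fun x y => ?_
  simp only [Set.indicator_apply, mem_closedBall_zero_iff]
  split_ifs with hx hy hy
  · exact hh.dist_le_mul x (by simpa using hx) y (by simpa using hy)
  · exact mixed x y hx (not_le.1 hy)
  · rw [dist_comm, dist_comm x]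
    exact mixed y x hy (not_le.1 hx)
  · simp only [dist_self]; positivity

/-- A small Lipschitz perturbation of the identity is bijective. -/
lemma LipschitzWith.bijective_id_add_smul {E : Type*} [NormedAddCommGroup E] [NormedSpace ℝ E]
    [CompleteSpace E] {K : NNReal} {H : E → E} (hH : LipschitzWith K H) {t : ℝ} (ht : 0 ≤ t)
    (htK : t * K < 1) : Function.Bijective fun x => x + t • H x := by
  have hd : ∀ x y, ‖t • H x - t • H y‖ ≤ t * K * ‖x - y‖ := by
    intro x y
    rw [← smul_sub, norm_smul, Real.norm_of_nonneg ht, mul_assoc]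
    gcongr
    simpa [dist_eq_norm] using hH.dist_le_mul x y
  constructor
  · intro x y hxy
    have h1 : x - y = -(t • H x - t • H y) := by
      have : x + t • H x = y + t • H y := hxy
      rw [neg_sub, sub_eq_sub_iff_add_eq_add, this, add_comm]
    have h2 := hd x y
    rw [← norm_neg, ← h1] at h2
    have h3 := norm_nonneg (x - y)
    have : ‖x - y‖ = 0 := by nlinarith
    exact sub_eq_zero.1 (norm_eq_zero.1 this)
  · intro y
    have hc : ContractingWith (⟨t, ht⟩ * K) fun x => y - t • H x := by
      refine ⟨by exact_mod_cast htK, LipschitzWith.of_dist_le_mul fun a b => ?_⟩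
      rw [dist_eq_norm, dist_eq_norm, sub_sub_sub_cancel_left, norm_sub_rev]
      exact hd a b
    have hf : y - t • H _ = _ := hc.fixedPoint_isFixedPt
    exact ⟨hc.fixedPoint _, by simp only; nth_rewrite 1 [← hf]; abel⟩

/-- There is no `C¹` retraction of the closed unit ball onto the unit sphere. -/
lemma not_exists_contDiff_retraction {E : Type*} [NormedAddCommGroup E] [InnerProductSpace ℝ E]
    [FiniteDimensional ℝ E] [MeasurableSpace E] [BorelSpace E] {r : E → E}
    (hr : ∀ x ∈ closedBall (0 : E) 1, ContDiffAt ℝ 1 r x)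
    (hr1 : ∀ x ∈ closedBall (0 : E) 1, ‖r x‖ = 1) : ¬ ∀ x, ‖x‖ = 1 → r x = x := by
  intro hfix
  have := FiniteDimensional.complete ℝ E
  have := FiniteDimensional.proper ℝ E
  set h : E → E := fun x => r x - x with h_def
  have hh : ∀ x ∈ closedBall (0 : E) 1, ContDiffAt ℝ 1 h x := fun x hx =>
    (hr x hx).sub contDiffAt_id
  have hDc : ContinuousOn (fderiv ℝ h) (closedBall 0 1) := fun x hx =>
    ((hh x hx).continuousAt_fderiv one_ne_zero).continuousWithinAt
  obtain ⟨K, hK⟩ : ∃ K : NNReal, ∀ x ∈ closedBall (0 : E) 1, ‖fderiv ℝ h x‖₊ ≤ K := by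
    obtain ⟨C, hC⟩ := (isCompact_closedBall (0 : E) 1).exists_bound_of_continuousOn hDc
    exact ⟨C.toNNReal, fun x hx => NNReal.le_toNNReal_of_coe_le (hC x hx)⟩
  have hd : ∀ x ∈ closedBall (0 : E) 1, DifferentiableAt ℝ h x := fun x hx =>
    (hh x hx).differentiableAt one_ne_zero
  have hlip := ((convex_closedBall (0 : E) 1).lipschitzOnWith_of_nnnorm_fderiv_le hd
    hK).extend_zero_closedBall (fun x hx => by simp [h_def, hfix x hx])
  have hsub : ball (0 : E) 1 ⊆ closedBall 0 1 := ball_subset_closedBall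
  -- for small `t` the map `id + t • h` is a bijection of the ball
  have hvol : ∀ t : ℝ, 0 ≤ t → t * K < 1 →
      ∫ x in ball (0 : E) 1, (1 + t • fderiv ℝ h x).det = volume.real (ball (0 : E) 1) := by
    intro t ht htK
    have hbij := hlip.bijective_id_add_smul ht htK
    set H := (closedBall (0 : E) 1).indicator h with H_def
    have hout : ∀ x ∉ ball (0 : E) 1, x + t • H x = x := by
      intro x hx
      have : H x = 0 := by
        by_cases hx1 : ‖x‖ = 1
        · simp [H_def, hx1, h_def, hfix x hx1]
        · refine Set.indicator_of_notMem (fun hx' => hx ?_) _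
          rw [mem_closedBall_zero_iff] at hx'
          exact mem_ball_zero_iff.2 (lt_of_le_of_ne hx' hx1)
      simp [this]
    have himg : (fun x => x + t • H x) '' ball 0 1 = ball 0 1 := by
      ext y
      constructor
      · rintro ⟨x, hx, rfl⟩
        by_contra hy
        have := hbij.1 (hout _ hy)
        exact hy (by simpa only [this] using hx)
      · intro hy
        obtain ⟨x, rfl⟩ := hbij.2 y
        by_cases hx : x ∈ ball (0 : E) 1
        · exact ⟨x, hx, rfl⟩
        · exact absurd (by simpa only [hout x hx] using hy) hx
    have hder : ∀ x ∈ ball (0 : E) 1,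
        HasFDerivWithinAt (fun x => x + t • H x) (1 + t • fderiv ℝ h x) (ball 0 1) x := by
      intro x hx
      have h1 : HasFDerivAt (fun x => x + t • h x) (1 + t • fderiv ℝ h x) x :=
        (hasFDerivAt_id x).add ((hd x (hsub hx)).hasFDerivAt.const_smul t)
      refine h1.hasFDerivWithinAt.congr (fun y hy => ?_) ?_
      · simp [H_def, Set.indicator_of_mem (hsub hy)]
      · simp [H_def, Set.indicator_of_mem (hsub hx)]
    have hcv := integral_image_eq_integral_abs_det_fderiv_smul volume measurableSet_ball hder
      hbij.1.injOn (fun _ => (1 : ℝ))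
    rw [himg] at hcv
    simp only [smul_eq_mul, mul_one, integral_const, measureReal_restrict_apply_univ] at hcv
    rw [hcv]
    refine setIntegral_congr_fun measurableSet_ball fun x hx => ?_
    refine (abs_of_pos (det_one_add_pos ?_)).symm
    rw [norm_smul, Real.norm_of_nonneg ht]
    exact lt_of_le_of_lt (mul_le_mul_of_nonneg_left (hK x (hsub hx)) ht) htK
  have hintegrable : ∀ t : ℝ, IntegrableOn (fun x => (1 + t • fderiv ℝ h x).det) (ball 0 1) := by
    intro t
    refine (ContinuousOn.integrableOn_compact (isCompact_closedBall (0 : E) 1) ?_).mono_set hsub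
    exact ContinuousLinearMap.continuous_det.comp_continuousOn
      (continuousOn_const.add (hDc.const_smul t))
  -- at `t = 1` the Jacobian vanishes
  have hdet : ∀ x ∈ ball (0 : E) 1, (1 + (1 : ℝ) • fderiv ℝ h x).det = 0 := by
    intro x hx
    have hrx := ((hr x (hsub hx)).differentiableAt one_ne_zero).hasFDerivAt
    have hD : 1 + (1 : ℝ) • fderiv ℝ h x = fderiv ℝ r x := by
      have : fderiv ℝ h x = fderiv ℝ r x - 1 := (hrx.sub (hasFDerivAt_id x)).fderiv
      rw [this, one_smul, add_sub_cancel]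
    rw [hD]
    by_contra hne
    have hsurj : Function.Surjective (fderiv ℝ r x) :=
      (LinearMap.equivOfDetNeZero _ hne).surjective
    obtain ⟨v, hv⟩ := hsurj (r x)
    have hconst : (fun y => inner ℝ (r y) (r y)) =ᶠ[nhds x] fun _ => (1 : ℝ) := by
      filter_upwards [isOpen_ball.mem_nhds hx] with y hy
      rw [real_inner_self_eq_norm_sq, hr1 y (hsub hy), one_pow]
    have h0 := ((hrx.inner ℝ hrx).congr_of_eventuallyEq hconst.symm).unique
      (hasFDerivAt_const (1 : ℝ) x)
    have h1 := DFunLike.congr_fun h0 v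
    simp [fderivInnerCLM_apply, hv, hr1 x (hsub hx)] at h1
  obtain ⟨w, hw1, hw⟩ := exists_weights_eval_one_eq_sum (Module.finrank ℝ E)
    (fun k : ℕ => 1 / ((K + 1) * ((k : ℝ) + 1))) (by
      intro a b hab
      have hK0 : (K : ℝ) + 1 ≠ 0 := by positivity
      simpa [hK0] using hab)
  have hpt : ∀ x, (1 + (1 : ℝ) • fderiv ℝ h x).det = ∑ k ∈ range (Module.finrank ℝ E + 1),
      w k * (1 + (1 / ((K + 1) * ((k : ℝ) + 1))) • fderiv ℝ h x).det := by
    intro x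
    obtain ⟨p, hp, hpe⟩ := exists_polynomial_eval_eq_det_one_add_smul (fderiv ℝ h x)
    simpa only [hpe] using hw p hp
  have hzero : ∫ x in ball (0 : E) 1, (1 + (1 : ℝ) • fderiv ℝ h x).det = 0 :=
    setIntegral_eq_zero_of_forall_eq_zero hdet
  have hone : ∫ x in ball (0 : E) 1, (1 + (1 : ℝ) • fderiv ℝ h x).det
      = volume.real (ball (0 : E) 1) := by
    simp_rw [hpt]
    rw [integral_finsetSum _ fun k _ => (hintegrable _).const_mul _]
    simp_rw [integral_const_mul]
    have hnode : ∀ k : ℕ, 1 / ((K + 1) * ((k : ℝ) + 1)) * K < 1 := fun k => by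
      rw [div_mul_eq_mul_div, div_lt_one (by positivity)]
      have : (0 : ℝ) ≤ k := k.cast_nonneg
      nlinarith [K.coe_nonneg]
    rw [sum_congr rfl fun k _ => by rw [hvol _ (by positivity) (hnode k)], ← sum_mul, hw1, one_mul]
  rw [hzero] at hone
  exact (ENNReal.toReal_pos (measure_ball_pos volume (0 : E) one_pos).ne'
    measure_ball_lt_top.ne).ne hone

/-- A `C¹` self-map of a Euclidean space with values in the open unit ball has a fixed point. -/
theorem exists_fixedPoint_of_norm_lt_one {E : Type*} [NormedAddCommGroup E]
    [InnerProductSpace ℝ E] [FiniteDimensional ℝ E] [MeasurableSpace E] [BorelSpace E]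
    {f : E → E} (hf : ContDiff ℝ 1 f) (hf1 : ∀ x, ‖f x‖ < 1) : ∃ x, f x = x := by
  by_contra! hne
  -- `x + s x • (x - f x)` is the point where the ray from `f x` through `x` leaves the ball
  let w : E → E := fun x => x - f x
  let q : E → ℝ := fun x => inner ℝ x (w x) ^ 2 + ‖w x‖ ^ 2 * (1 - ‖x‖ ^ 2)
  let s : E → ℝ := fun x => (-inner ℝ x (w x) + √(q x)) / ‖w x‖ ^ 2
  have hw0 : ∀ x, ‖w x‖ ^ 2 ≠ 0 := fun x =>
    pow_ne_zero _ (norm_ne_zero_iff.2 (sub_ne_zero.2 (hne x).symm))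
  have hw : ContDiff ℝ 1 w := contDiff_id.sub hf
  have hsphere : ∀ x, ‖x‖ = 1 → 0 < inner ℝ x (w x) := by
    intro x hx
    have h1 : inner ℝ x (f x) ≤ ‖x‖ * ‖f x‖ := real_inner_le_norm _ _
    have h2 := hf1 x
    simp only [w, inner_sub_right, real_inner_self_eq_norm_sq, hx] at *
    linarith
  have hq : ∀ x ∈ closedBall (0 : E) 1, 0 < q x := by
    intro x hx
    rw [mem_closedBall_zero_iff] at hx
    rcases hx.lt_or_eq with h | h
    · have h1 : 0 < 1 - ‖x‖ ^ 2 := by nlinarith [norm_nonneg x]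
      have h2 : 0 < ‖w x‖ ^ 2 := lt_of_le_of_ne (by positivity) (hw0 x).symm
      simp only [q]; positivity
    · have := hsphere x h
      simp only [q, h]; norm_num; positivity
  refine not_exists_contDiff_retraction (r := fun x => x + s x • w x) ?_ ?_ ?_
  · intro x hx
    have hi : ContDiff ℝ 1 fun x => inner ℝ x (w x) := contDiff_id.inner ℝ hw
    have hqc : ContDiff ℝ 1 q :=
      (hi.pow 2).add ((hw.norm_sq ℝ).mul (contDiff_const.sub (contDiff_id.norm_sq ℝ)))
    refine contDiffAt_id.add (ContDiffAt.smul ?_ hw.contDiffAt)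
    exact (hi.neg.contDiffAt.add (hqc.contDiffAt.sqrt (hq x hx).ne')).div
      (hw.norm_sq ℝ).contDiffAt (hw0 x)
  · intro x hx
    have h1 : ‖x + s x • w x‖ ^ 2 = 1 := by
      have h2 := Real.sq_sqrt (hq x hx).le
      have h3 : s x * ‖w x‖ ^ 2 = -inner ℝ x (w x) + √(q x) := div_mul_cancel₀ _ (hw0 x)
      have h4 : (s x * ‖w x‖ ^ 2 + inner ℝ x (w x)) ^ 2 = q x := by
        rw [h3, neg_add_cancel_comm, h2]
      rw [norm_add_sq_real, inner_smul_right, norm_smul, mul_pow, Real.norm_eq_abs, sq_abs]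
      have h5 : ‖w x‖ ^ 2 * (‖x‖ ^ 2 + 2 * (s x * inner ℝ x (w x)) + s x ^ 2 * ‖w x‖ ^ 2)
          = ‖w x‖ ^ 2 * 1 := by
        simp only [q] at h4
        linear_combination h4
      exact mul_left_cancel₀ (hw0 x) h5
    exact (pow_eq_one_iff_of_nonneg (norm_nonneg _) two_ne_zero).1 h1
  · intro x hx
    have : s x = 0 := by
      simp [s, q, hx, Real.sqrt_sq (hsphere x hx).le]
    simp [this]

/-- A bounded continuous self-map of a Euclidean space has a fixed point. -/
theorem exists_fixedPoint_of_bounded {E : Type*} [NormedAddCommGroup E]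
    [InnerProductSpace ℝ E] [FiniteDimensional ℝ E] [MeasurableSpace E] [BorelSpace E]
    {F : E → E} (hF : Continuous F) {R : ℝ} (hR : ∀ x, ‖F x‖ ≤ R) : ∃ x, F x = x := by
  have := FiniteDimensional.proper ℝ E
  by_contra! hne
  have hR0 : 0 ≤ R := (norm_nonneg _).trans (hR 0)
  obtain ⟨x₀, -, hx₀⟩ := (isCompact_closedBall (0 : E) (R + 1)).exists_isMinOn
    ⟨0, by simp; linarith⟩ (f := fun x => ‖F x - x‖) (by fun_prop)
  have hδ : 0 < ‖F x₀ - x₀‖ := norm_pos_iff.2 (sub_ne_zero.2 (hne x₀))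
  obtain ⟨g, hg, hgF, -⟩ := hF.exists_contDiff_approx 1
    (ε := fun _ => min 1 ‖F x₀ - x₀‖) continuous_const (fun _ => lt_min one_pos hδ)
  have hgF' : ∀ x, ‖g x - F x‖ < 1 ∧ ‖g x - F x‖ < ‖F x₀ - x₀‖ := fun x => by
    simpa [dist_eq_norm] using hgF x
  have hgR : ∀ x, ‖g x‖ < R + 1 := fun x => by
    have h1 := norm_add_le (F x) (g x - F x)
    rw [add_sub_cancel] at h1
    linarith [(hgF' x).1, hR x]
  have hR1 : 0 < R + 1 := by linarith
  obtain ⟨y, hy⟩ := exists_fixedPoint_of_norm_lt_one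
    (f := fun x => (R + 1)⁻¹ • g ((R + 1) • x))
    ((hg.comp (contDiff_id.const_smul (R + 1))).const_smul (R + 1)⁻¹) (fun x => by
      rw [norm_smul, Real.norm_of_nonneg (by positivity), inv_mul_lt_one₀ hR1]
      exact hgR _)
  have hfix : g ((R + 1) • y) = (R + 1) • y := by
    rwa [inv_smul_eq_iff₀ hR1.ne'] at hy
  have h1 := (hgF' ((R + 1) • y)).2
  have h2 : ‖F x₀ - x₀‖ ≤ ‖F ((R + 1) • y) - (R + 1) • y‖ := hx₀ (by
    rw [mem_closedBall_zero_iff, ← hfix]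
    exact (hgR _).le)
  rw [hfix, norm_sub_rev] at h1
  exact absurd h1 h2.not_gt

/-- A continuous self-map of `ι → ℝ` with bounded coordinates has a fixed point. -/
theorem exists_fixedPoint_of_forall_abs_le_one {ι : Type*} [Fintype ι]
    {F : (ι → ℝ) → ι → ℝ} (hF : Continuous F) (hb : ∀ x k, |F x k| ≤ 1) : ∃ x, F x = x := by
  obtain ⟨y, hy⟩ := exists_fixedPoint_of_bounded (E := EuclideanSpace ℝ ι)
    (F := fun x => WithLp.toLp 2 (F x.ofLp)) (R := √(Fintype.card ι)) (by fun_prop) (fun x => by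
      rw [EuclideanSpace.norm_eq]
      refine Real.sqrt_le_sqrt ((sum_le_card_nsmul univ _ 1 fun k _ => ?_).trans (by simp))
      simpa using hb x.ofLp k)
  exact ⟨y.ofLp, congrArg WithLp.ofLp hy⟩

end Brouwer

section Normalization

variable {α : Type*} [Fintype α]

/-- A continuous map onto the probability simplex which fixes every distribution. -/
def toDist (x : α → ℝ) (a : α) : ℝ :=
  (max 0 (x a) + max 0 (1 - ∑ b, max 0 (x b)) / Fintype.card α) / max 1 (∑ b, max 0 (x b))

lemma isDist_toDist [Nonempty α] (x : α → ℝ) : IsDist (toDist x) := by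
  refine ⟨fun a => by unfold toDist; positivity, ?_⟩
  unfold toDist
  rw [← sum_div, sum_add_distrib, sum_const, card_univ, nsmul_eq_mul,
    mul_div_cancel₀ _ (by positivity)]
  rcases le_total (∑ b, max 0 (x b)) 1 with h | h
  · rw [max_eq_left h, max_eq_right (by linarith)]
    norm_num
  · rw [max_eq_right h, max_eq_left (by linarith), add_zero, div_self (by linarith)]

lemma IsDist.toDist_eq {x : α → ℝ} (hx : IsDist x) : toDist x = x := by
  funext a
  simp [toDist, hx.1, hx.2]

lemma IsDist.abs_le_one {x : α → ℝ} (hx : IsDist x) (a : α) : |x a| ≤ 1 := by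
  rw [abs_of_nonneg (hx.1 a), ← hx.2]
  exact single_le_sum (fun b _ => hx.1 b) (mem_univ a)

lemma continuous_toDist : Continuous (toDist : (α → ℝ) → α → ℝ) := by
  unfold toDist
  refine continuous_pi fun a => Continuous.div (by fun_prop) (by fun_prop) fun x => ?_
  exact (lt_of_lt_of_le one_pos (le_max_left _ _)).ne'

lemma IsDist.add_div {x g : α → ℝ} (hx : IsDist x) (hg : ∀ a, 0 ≤ g a) :
    IsDist fun a => (x a + g a) / (1 + ∑ b, g b) := by
  have h0 : 0 ≤ ∑ b, g b := sum_nonneg fun b _ => hg b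
  refine ⟨fun a => div_nonneg (add_nonneg (hx.1 a) (hg a)) (by linarith), ?_⟩
  rw [← sum_div, sum_add_distrib, hx.2, div_self (by linarith)]

/-- A distribution fixed by the gain-adjustment map puts no value above the mean. -/
lemma IsDist.le_mean_of_fixed {x v : α → ℝ} (hx : IsDist x)
    (hfix : ∀ a, (x a + max 0 (v a - ∑ b, v b * x b)) /
      (1 + ∑ c, max 0 (v c - ∑ b, v b * x b)) = x a) (a : α) : v a ≤ ∑ b, v b * x b := by
  set m := ∑ b, v b * x b with hm
  have h0 : 0 ≤ ∑ c, max 0 (v c - m) := sum_nonneg fun c _ => le_max_left _ _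
  have hgain : ∀ a, max 0 (v a - m) = x a * ∑ c, max 0 (v c - m) := by
    intro a
    have := hfix a
    rw [div_eq_iff (by linarith)] at this
    linarith
  have hsq : ∑ a, max 0 (v a - m) ^ 2 = 0 := by
    calc ∑ a, max 0 (v a - m) ^ 2 = ∑ a, max 0 (v a - m) * (v a - m) :=
          sum_congr rfl fun a _ => by
            rcases le_total 0 (v a - m) with h | h
            · rw [max_eq_right h, sq]
            · rw [max_eq_left h]; ring
      _ = ∑ a, (v a * x a - m * x a) * ∑ c, max 0 (v c - m) :=
          sum_congr rfl fun a _ => by rw [hgain a]; ring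
      _ = 0 := by rw [← sum_mul, sum_sub_distrib, ← mul_sum, hx.2, ← hm]; ring
  have := (sum_eq_zero_iff_of_nonneg fun a _ => sq_nonneg _).1 hsq a (mem_univ a)
  have h1 : v a - m ≤ 0 := (le_max_right _ _).trans (pow_eq_zero_iff two_ne_zero |>.1 this).le
  linarith

end Normalization

lemma continuous_EUmat (U : ∀ i : Fin N, (∀ j : Fin N, A j) → Θ → ℝ) (i : Fin N) (ai : A i)
    (θ : Θ) : Continuous fun σ : ∀ j : Fin N, A j → ℝ => EUmat U σ i ai θ := by
  unfold EUmat piProb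
  fun_prop

lemma continuous_ERparam (U : ∀ i : Fin N, (∀ j : Fin N, A j) → Θ → ℝ) (i : Fin N) (θ : Θ) :
    Continuous fun σ : ∀ j : Fin N, A j → ℝ => ERparam U σ i θ := by
  have h := continuous_EUmat U i
  have hs : Continuous fun σ : ∀ j : Fin N, A j → ℝ =>
      univ.sup' univ_nonempty fun ci : A i => EUmat U σ i ci θ :=
    Continuous.finset_sup'_apply _ fun ci _ => h ci θ
  unfold ERparam ERmat
  fun_prop

lemma continuous_Upsilon (U : ∀ i : Fin N, (∀ j : Fin N, A j) → Θ → ℝ) :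
    Continuous (Upsilon U) := by
  have hu : ∀ i (ai : A i), Continuous fun ρ : (∀ i, A i → ℝ) × (Fin N → Θ → ℝ) =>
      EUact U ρ.1 ρ.2 i ai := fun i ai => by
    have h := fun θ => (continuous_EUmat U i ai θ).comp
      (continuous_fst (X := ∀ i, A i → ℝ) (Y := Fin N → Θ → ℝ))
    simp only [Function.comp_def] at h
    unfold EUact
    fun_prop
  have hr : ∀ i (θ : Θ), Continuous fun ρ : (∀ i, A i → ℝ) × (Fin N → Θ → ℝ) =>
      ERparam U ρ.1 i θ := fun i θ => (continuous_ERparam U i θ).comp continuous_fst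
  refine Continuous.prodMk (continuous_pi fun i => continuous_pi fun ai => ?_)
    (continuous_pi fun i => continuous_pi fun θ => ?_)
  · unfold nextStrat phi EUtot
    refine Continuous.div (by fun_prop) (by fun_prop) fun ρ => ?_
    positivity
  · unfold nextPrior psi ERtot
    refine Continuous.div (by fun_prop) (by fun_prop) fun ρ => ?_
    positivity

/-- `Υ` has a fixed point among the complete strategy profiles. -/
theorem exists_isDist_Upsilon_eq (U : ∀ i : Fin N, (∀ j : Fin N, A j) → Θ → ℝ) :
    ∃ ρ : (∀ i, A i → ℝ) × (Fin N → Θ → ℝ),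
      (∀ i, IsDist (ρ.1 i)) ∧ (∀ i, IsDist (ρ.2 i)) ∧ Upsilon U ρ = ρ := by
  let normalize : ((Σ i, A i) ⊕ (Fin N × Θ) → ℝ) → (∀ i, A i → ℝ) × (Fin N → Θ → ℝ) := fun x =>
    (fun i => toDist fun a => x (.inl ⟨i, a⟩), fun i => toDist fun θ => x (.inr (i, θ)))
  let flat : (∀ i, A i → ℝ) × (Fin N → Θ → ℝ) → (Σ i, A i) ⊕ (Fin N × Θ) → ℝ := fun ρ =>
    Sum.elim (fun k => ρ.1 k.1 k.2) (fun k => ρ.2 k.1 k.2)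
  have hnorm : Continuous normalize := by
    refine Continuous.prodMk (continuous_pi fun i => ?_) (continuous_pi fun i => ?_) <;>
      exact continuous_toDist.comp (by fun_prop)
  have hflat : Continuous flat := by
    refine continuous_pi ?_
    rintro (k | k) <;> simp only [flat, Sum.elim_inl, Sum.elim_inr] <;> fun_prop
  have hσ : ∀ x i, IsDist ((Upsilon U (normalize x)).1 i) := fun x i =>
    (isDist_toDist _).add_div fun _ => le_max_left _ _
  have hπ : ∀ x i, IsDist ((Upsilon U (normalize x)).2 i) := fun x i =>
    (isDist_toDist _).add_div fun _ => le_max_left _ _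
  obtain ⟨x, hx⟩ := exists_fixedPoint_of_forall_abs_le_one
    (F := fun x => flat (Upsilon U (normalize x)))
    (hflat.comp ((continuous_Upsilon U).comp hnorm)) (by
      rintro x (k | k)
      · exact (hσ x k.1).abs_le_one k.2
      · exact (hπ x k.1).abs_le_one k.2)
  have hfix : normalize x = Upsilon U (normalize x) := by
    conv_lhs => rw [← hx]
    exact Prod.ext (funext fun i => (hσ x i).toDist_eq) (funext fun i => (hπ x i).toDist_eq)
  exact ⟨normalize x, fun i => isDist_toDist _, fun i => isDist_toDist _, hfix.symm⟩

/-- existence of an extended equilibrium for any finite game with uncertainty. -/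
theorem extended_equilibrium_exists
    (U : ∀ i : Fin N, (∀ j : Fin N, A j) → Θ → ℝ) :
    ∃ (σ : ∀ j : Fin N, A j → ℝ) (π : Fin N → Θ → ℝ),
      (∀ i, IsDist (σ i)) ∧ (∀ i, IsDist (π i)) ∧ ExtendedEquilibrium U σ π := by
  obtain ⟨ρ, hσ, hπ, hfix⟩ := exists_isDist_Upsilon_eq U
  refine ⟨ρ.1, ρ.2, hσ, hπ, fun i ai => ?_, fun i θ => ?_⟩
  · exact (hσ i).le_mean_of_fixed (v := EUact U ρ.1 ρ.2 i)
      (fun a => congrFun (congrFun (congrArg Prod.fst hfix) i) a) ai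
  · exact (hπ i).le_mean_of_fixed (v := ERparam U ρ.1 i)
      (fun χ => congrFun (congrFun (congrArg Prod.snd hfix) i) χ) θ
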